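/- Let N ≥ 1 and let u_x : I → (0,1), x ∈ T_N^d, be differentiable on an interval I; write u_x = u_x(t), η̄_x := η_x − u_x, and let ν_t be the product measure on X_N with means u_x(t). Assume the exchange rates c_{x,y} : X_N → (0,∞) (|x−y|=1) satisfy c_{x,y} = c_{y,x} and c_{x,y}(η^{x,y}) = c_{x,y}(η), and the flip rates c_x(η) = c_x⁺(η)(1−η_x) + c_x⁻(η)η_x ≥ 0 with c_x^± not depending on η_x. Let L_N = N²L_K + K L_G with K ≥ 1, and ψ_t := dν_t/dm for a fixed full-support reference measure m. Then for every η ∈ X_N and t ∈ I: L_N^{*,ν_t}𝟙(η) − ∂_t log ψ_t(η) = −(N²/2) Σ_{x,y: |x−y|=1} ((u_y − u_x)²/(χ(u_x)χ(u_y))) c_{x,y}(η) η̄_x η̄_y + (N²/2) Σ_{x,y: |x−y|=1} c_{x,y}(η)( η̄_x/χ(u_x) − η̄_y/χ(u_y) )(u_y − u_x) + K Σ_x ( c_x⁺(η)/u_x − c_x⁻(η)/(1−u_x) ) η̄_x − Σ_x ∂_t u_x · η̄_x/χ(u_x). -/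

import Mathlib

namespace GK

open Finset

noncomputable section

/-- Occupation value of a site as a real number. -/
def bval (b : Bool) : ℝ := if b then 1 else 0

/-- Bernoulli weight with mean `ρ`. -/
def bern (ρ : ℝ) (b : Bool) : ℝ := if b then ρ else 1 - ρ

/-- Compressibility. -/
def chi (ρ : ℝ) : ℝ := ρ * (1 - ρ)

/-- The `i`-th unit vector of `ℤ^d`. -/
def zvec (d : ℕ) (i : Fin d) : Fin d → ℤ := Pi.single i 1

/-- A function on `{0,1}^{ℤ^d}` depends only on the coordinates in `S`. -/
def IsLocal {d : ℕ} (S : Finset (Fin d → ℤ)) (h : ((Fin d → ℤ) → Bool) → ℝ) : Prop :=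
  ∀ η η' : (Fin d → ℤ) → Bool, (∀ x ∈ S, η x = η' x) → h η = h η'

/-- Expectation under the Bernoulli product measure with mean `ρ`
of a function depending only on the coordinates in `S`. -/
def bExp {d : ℕ} (ρ : ℝ) (S : Finset (Fin d → ℤ)) (h : ((Fin d → ℤ) → Bool) → ℝ) : ℝ :=
  ∑ ζ : {x // x ∈ S} → Bool,
    (∏ x : {x // x ∈ S}, bern ρ (ζ x)) *
      h fun z => if hz : z ∈ S then ζ ⟨z, hz⟩ else false

/-- Exchange of the values at `x` and `y` (lattice version). -/
def exchL {d : ℕ} (η : (Fin d → ℤ) → Bool) (x y : Fin d → ℤ) : (Fin d → ℤ) → Bool :=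
  Function.update (Function.update η x (η y)) y (η x)

/-- Translation by `x`. -/
def transl {d : ℕ} (x : Fin d → ℤ) (η : (Fin d → ℤ) → Bool) : (Fin d → ℤ) → Bool :=
  fun z => η (z + x)

/-- Discrete torus. -/
abbrev Tor (d N : ℕ) := Fin d → ZMod N

/-- Configuration space on the torus. -/
abbrev Conf (d N : ℕ) := Tor d N → Bool

/-- Unit vector on torus. -/
def uvec (d N : ℕ) (i : Fin d) : Tor d N := Pi.single i 1

/-- Exchange of values at `x,y`. -/
def exchT {d N : ℕ} (η : Conf d N) (x y : Tor d N) : Conf d N :=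
  Function.update (Function.update η x (η y)) y (η x)

/-- Flip value at `x`. -/
def flipT {d N : ℕ} (η : Conf d N) (x : Tor d N) : Conf d N :=
  Function.update η x (!(η x))

/-- Cast a lattice vector to the torus. -/
def castT (d N : ℕ) (z : Fin d → ℤ) : Tor d N := fun j => (z j : ZMod N)

/-- Configuration observed around torus point `x`, as a lattice configuration. -/
def obs {d N : ℕ} (η : Conf d N) (x : Tor d N) : (Fin d → ℤ) → Bool :=
  fun z => η (x + castT d N z)

/-- Sum over ordered nearest-neighbour pairs `(x,y)`, `|x-y|=1`. -/
def nnSum (d N : ℕ) [NeZero N] (F : Tor d N → Tor d N → ℝ) : ℝ :=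
  ∑ x : Tor d N, ∑ i : Fin d, (F x (x + uvec d N i) + F x (x - uvec d N i))

/-- Kawasaki generator with exchange rates `cc`. -/
def LK (d N : ℕ) [NeZero N] (cc : Tor d N → Tor d N → Conf d N → ℝ)
    (f : Conf d N → ℝ) (η : Conf d N) : ℝ :=
  (1/2) * ∑ x : Tor d N, ∑ i : Fin d,
    (cc x (x + uvec d N i) η * (f (exchT η x (x + uvec d N i)) - f η)
      + cc x (x - uvec d N i) η * (f (exchT η x (x - uvec d N i)) - f η))

/-- Glauber generator with flip rates `cG`. -/
def LG (d N : ℕ) [NeZero N] (cG : Tor d N → Conf d N → ℝ)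
    (f : Conf d N → ℝ) (η : Conf d N) : ℝ :=
  ∑ x : Tor d N, cG x η * (f (flipT η x) - f η)

/-- Product (Bernoulli) measure with means `u`. -/
def prodM (d N : ℕ) [NeZero N] (u : Tor d N → ℝ) (η : Conf d N) : ℝ :=
  ∏ x : Tor d N, bern (u x) (η x)

/-- Relative entropy. -/
def relEnt {d N : ℕ} [NeZero N] (μ ν : Conf d N → ℝ) : ℝ :=
  ∑ η : Conf d N, μ η * Real.log (μ η / ν η)

/-- Box `[-ℓ,ℓ]^d` in `ℤ^d`. -/
def box (d ℓ : ℕ) : Finset (Fin d → ℤ) :=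
  Fintype.piFinset fun _ => Finset.Icc (-(ℓ:ℤ)) (ℓ:ℤ)

/-- `ℓ`-ball (sup-norm box) around `z` in the torus. -/
def ball (d N : ℕ) (ℓ : ℕ) (z : Tor d N) : Finset (Tor d N) :=
  (box d ℓ).image fun w => z + castT d N w

/-- Block average of a configuration around `x`. -/
def avg (d N : ℕ) (ℓ : ℕ) (x : Tor d N) (η : Conf d N) : ℝ :=
  (1 / (2*(ℓ:ℝ)+1)^d) * ∑ w ∈ box d ℓ, bval (η (x + castT d N w))

open scoped Classical in
/-- Conditional expectation of `F` given the block average `avg` around `x`, under the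
Bernoulli(1/2) product measure. -/
def condExpUnif (d N : ℕ) [NeZero N] (ℓ : ℕ) (x : Tor d N)
    (F : Conf d N → ℝ) (η : Conf d N) : ℝ :=
  (∑ η' : Conf d N, if avg d N ℓ x η' = avg d N ℓ x η
      then F η' * prodM d N (fun _ => (1:ℝ)/2) η' else 0)
    / ∑ η' : Conf d N, if avg d N ℓ x η' = avg d N ℓ x η
        then prodM d N (fun _ => (1:ℝ)/2) η' else 0

/-- The full generator `N² L_K + K L_G` built from translation-invariant lattice rates
`cK i = c_{0,e_i}` and flip rate `cG = c_0`. -/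
def LNgen (d N : ℕ) [NeZero N] (Ksc : ℝ)
    (cK : Fin d → ((Fin d → ℤ) → Bool) → ℝ)
    (cG : ((Fin d → ℤ) → Bool) → ℝ)
    (f : Conf d N → ℝ) (η : Conf d N) : ℝ :=
  (N:ℝ)^2 * ((1/2) * ∑ x : Tor d N, ∑ i : Fin d,
      (cK i (obs η x) * (f (exchT η x (x + uvec d N i)) - f η)
        + cK i (obs η (x - uvec d N i)) * (f (exchT η x (x - uvec d N i)) - f η)))
    + Ksc * ∑ x : Tor d N, cG (obs η x) * (f (flipT η x) - f η)


/-- Updating one site changes the product weight by the ratio of the Bernoulli weights there. -/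
lemma prodM_update_mul (d N : ℕ) [NeZero N] (u : Tor d N → ℝ) (η : Conf d N) (x : Tor d N)
    (b : Bool) :
    prodM d N u (Function.update η x b) * bern (u x) (η x)
      = prodM d N u η * bern (u x) b := by
  unfold prodM
  rw [← Finset.mul_prod_erase univ _ (mem_univ x), ← Finset.mul_prod_erase univ
    (fun z => bern (u z) (η z)) (mem_univ x)]
  have h : ∏ z ∈ univ.erase x, bern (u z) (Function.update η x b z)
      = ∏ z ∈ univ.erase x, bern (u z) (η z) :=
    prod_congr rfl fun z hz => by rw [Function.update_of_ne (ne_of_mem_erase hz)]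
  rw [h, Function.update_self]
  ring

lemma bern_pos {ρ : ℝ} (hρ : ρ ∈ Set.Ioo (0 : ℝ) 1) (b : Bool) : 0 < bern ρ b := by
  cases b
  · simpa [bern] using hρ.2
  · simpa [bern] using hρ.1

lemma prodM_pos (d N : ℕ) [NeZero N] (u : Tor d N → ℝ) (hu : ∀ x, u x ∈ Set.Ioo (0 : ℝ) 1)
    (η : Conf d N) : 0 < prodM d N u η :=
  Finset.prod_pos fun x _ => bern_pos (hu x) (η x)

lemma exchT_involutive {d N : ℕ} (x y : Tor d N) :
    Function.Involutive fun η : Conf d N => exchT η x y := by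
  intro η
  funext z
  by_cases hy : z = y <;> by_cases hx : z = x <;> by_cases hxy : x = y <;>
    simp_all [exchT, Function.update_apply]

lemma flipT_involutive {d N : ℕ} (x : Tor d N) :
    Function.Involutive fun η : Conf d N => flipT η x := by
  intro η
  simp [flipT]

/-- The relative change of the product weight under the exchange of the values at `x` and `y`. -/
def exchDefect {d N : ℕ} (u : Tor d N → ℝ) (η : Conf d N) (x y : Tor d N) : ℝ :=
  -((u y - u x) ^ 2 / (chi (u x) * chi (u y)) * (bval (η x) - u x) * (bval (η y) - u y))
    + ((bval (η x) - u x) / chi (u x) - (bval (η y) - u y) / chi (u y)) * (u y - u x)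

lemma prodM_exchT_sub (d N : ℕ) [NeZero N] (u : Tor d N → ℝ)
    (hu : ∀ x, u x ∈ Set.Ioo (0 : ℝ) 1) (η : Conf d N) (x y : Tor d N) :
    prodM d N u (exchT η x y) - prodM d N u η = exchDefect u η x y * prodM d N u η := by
  by_cases hxy : x = y
  · subst hxy
    simp [exchT, exchDefect]
  have h1 := prodM_update_mul d N u η x (η y)
  have h2 := prodM_update_mul d N u (Function.update η x (η y)) y (η x)
  rw [Function.update_of_ne (Ne.symm hxy)] at h2
  have hx0 := (hu x).1.ne'
  have hx1 := (sub_pos.2 (hu x).2).ne'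
  have hy0 := (hu y).1.ne'
  have hy1 := (sub_pos.2 (hu y).2).ne'
  have hbx := (bern_pos (hu x) (η x)).ne'
  have hby := (bern_pos (hu y) (η y)).ne'
  have h3 : prodM d N u (exchT η x y)
      = prodM d N u η * bern (u x) (η y) / bern (u x) (η x) * bern (u y) (η x)
        / bern (u y) (η y) := by
    rw [eq_div_iff hby, ← h1, mul_div_cancel_right₀ _ hbx]
    exact h2
  rw [h3]
  cases hηx : η x <;> cases hηy : η y <;>
    simp only [exchDefect, chi, bval, bern, hηx, hηy, if_true, if_false, Bool.false_eq_true] <;>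
    field_simp <;> ring

lemma sum_exchange_mul_prodM (d N : ℕ) [NeZero N] (u : Tor d N → ℝ)
    (hu : ∀ x, u x ∈ Set.Ioo (0 : ℝ) 1) (x y : Tor d N) (c : Conf d N → ℝ)
    (hc : ∀ η, c (exchT η x y) = c η) (f : Conf d N → ℝ) :
    ∑ η, c η * (f (exchT η x y) - f η) * prodM d N u η
      = ∑ η, c η * exchDefect u η x y * f η * prodM d N u η := by
  have h : ∑ η, c η * f (exchT η x y) * prodM d N u η
      = ∑ η, c η * f η * prodM d N u (exchT η x y) := by
    rw [← Equiv.sum_comp (exchT_involutive x y).toPerm]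
    refine Finset.sum_congr rfl fun η _ => ?_
    have hinv : exchT (exchT η x y) x y = η := exchT_involutive x y η
    simp only [Function.Involutive.coe_toPerm, hinv, hc]
  simp only [mul_sub, sub_mul, Finset.sum_sub_distrib]
  rw [h, ← Finset.sum_sub_distrib]
  refine Finset.sum_congr rfl fun η _ => ?_
  linear_combination c η * f η * prodM_exchT_sub d N u hu η x y

lemma sum_flip_mul_prodM (d N : ℕ) [NeZero N] (u : Tor d N → ℝ)
    (hu : ∀ x, u x ∈ Set.Ioo (0 : ℝ) 1) (x : Tor d N) (c cp cm : Conf d N → ℝ)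
    (hdecomp : ∀ η, c η = cp η * (1 - bval (η x)) + cm η * bval (η x))
    (hcp : ∀ η b, cp (Function.update η x b) = cp η)
    (hcm : ∀ η b, cm (Function.update η x b) = cm η) (f : Conf d N → ℝ) :
    ∑ η, c η * (f (flipT η x) - f η) * prodM d N u η
      = ∑ η, (cp η / u x - cm η / (1 - u x)) * (bval (η x) - u x) * f η * prodM d N u η := by
  have h : ∑ η, c η * f (flipT η x) * prodM d N u η
      = ∑ η, c (flipT η x) * f η * prodM d N u (flipT η x) := by
    rw [← Equiv.sum_comp (flipT_involutive x).toPerm]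
    refine Finset.sum_congr rfl fun η _ => ?_
    have hinv : flipT (flipT η x) x = η := flipT_involutive x η
    simp only [Function.Involutive.coe_toPerm, hinv]
  rw [Finset.sum_congr rfl fun η _ => show c η * (f (flipT η x) - f η) * prodM d N u η
    = c η * f (flipT η x) * prodM d N u η - c η * f η * prodM d N u η by ring,
    Finset.sum_sub_distrib, h, ← Finset.sum_sub_distrib]
  refine Finset.sum_congr rfl fun η _ => ?_
  have h1 := prodM_update_mul d N u η x (!(η x))
  have hx0 := (hu x).1.ne'
  have hx1 := (sub_pos.2 (hu x).2).ne'
  rw [← eq_div_iff (bern_pos (hu x) (η x)).ne'] at h1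
  rw [hdecomp, hdecomp η, flipT, h1, hcp, hcm, Function.update_self]
  cases hηx : η x <;>
    simp only [bval, bern, Bool.not_true, Bool.not_false, if_true, if_false,
      Bool.false_eq_true] <;>
    field_simp <;> ring

lemma sum_LK_mul_prodM (d N : ℕ) [NeZero N] (u : Tor d N → ℝ)
    (hu : ∀ x, u x ∈ Set.Ioo (0 : ℝ) 1) (cc : Tor d N → Tor d N → Conf d N → ℝ)
    (hrev : ∀ (x : Tor d N) (i : Fin d) (η : Conf d N),
      cc x (x + uvec d N i) (exchT η x (x + uvec d N i)) = cc x (x + uvec d N i) η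
      ∧ cc x (x - uvec d N i) (exchT η x (x - uvec d N i)) = cc x (x - uvec d N i) η)
    (f : Conf d N → ℝ) :
    ∑ η, LK d N cc f η * prodM d N u η
      = ∑ η, 1 / 2 * nnSum d N (fun x y => cc x y η * exchDefect u η x y)
          * f η * prodM d N u η := by
  simp only [LK, nnSum, mul_assoc (1 / 2 : ℝ), ← Finset.mul_sum]
  congr 1
  simp only [Finset.sum_mul, add_mul]
  rw [Finset.sum_comm, Finset.sum_comm (s := Finset.univ (α := Conf d N))]
  refine Finset.sum_congr rfl fun x _ => ?_
  rw [Finset.sum_comm, Finset.sum_comm (s := Finset.univ (α := Conf d N))]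
  refine Finset.sum_congr rfl fun i _ => ?_
  simp only [Finset.sum_add_distrib]
  rw [sum_exchange_mul_prodM d N u hu _ _ _ (fun η => (hrev x i η).1),
    sum_exchange_mul_prodM d N u hu _ _ _ (fun η => (hrev x i η).2)]

lemma sum_LG_mul_prodM (d N : ℕ) [NeZero N] (u : Tor d N → ℝ)
    (hu : ∀ x, u x ∈ Set.Ioo (0 : ℝ) 1) (cG cp cm : Tor d N → Conf d N → ℝ)
    (hdecomp : ∀ x η, cG x η = cp x η * (1 - bval (η x)) + cm x η * bval (η x))
    (hcp : ∀ x η b, cp x (Function.update η x b) = cp x η)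
    (hcm : ∀ x η b, cm x (Function.update η x b) = cm x η) (f : Conf d N → ℝ) :
    ∑ η, LG d N cG f η * prodM d N u η
      = ∑ η, (∑ x, (cp x η / u x - cm x η / (1 - u x)) * (bval (η x) - u x))
          * f η * prodM d N u η := by
  simp only [LG, Finset.sum_mul]
  rw [Finset.sum_comm, Finset.sum_comm (s := Finset.univ (α := Conf d N))]
  exact Finset.sum_congr rfl fun x _ =>
    sum_flip_mul_prodM d N u hu x _ _ _ (hdecomp x) (hcp x) (hcm x) f

/-- A function on configurations is determined by its integrals against a full-support weight. -/
lemma eq_of_forall_sum_mul_eq {α : Type*} [Fintype α] (ν g h : α → ℝ) (hν : ∀ a, ν a ≠ 0)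
    (H : ∀ f : α → ℝ, ∑ a, g a * f a * ν a = ∑ a, h a * f a * ν a) : g = h := by
  classical
  funext a
  have := H (Pi.single a 1)
  simp only [Pi.single_apply, mul_ite, ite_mul, mul_one, mul_zero, zero_mul,
    Finset.sum_ite_eq', Finset.mem_univ, if_true] at this
  exact mul_right_cancel₀ (hν a) this

lemma hasDerivAt_log_prodM_div (d N : ℕ) [NeZero N] (u : Tor d N → ℝ → ℝ) (u' : Tor d N → ℝ)
    (I : Set ℝ) (hI : IsOpen I) (hu : ∀ x, ∀ t ∈ I, u x t ∈ Set.Ioo (0 : ℝ) 1)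
    (t : ℝ) (ht : t ∈ I) (hderiv : ∀ x, HasDerivAt (u x) (u' x) t) (η : Conf d N)
    (a : ℝ) (ha : a ≠ 0) :
    HasDerivAt (fun s => Real.log (prodM d N (fun x => u x s) η / a))
      (∑ x, u' x * (bval (η x) - u x t) / chi (u x t)) t := by
  have hsum : HasDerivAt (fun s => ∑ x, Real.log (bern (u x s) (η x)) - Real.log a)
      (∑ x, u' x * (bval (η x) - u x t) / chi (u x t)) t := by
    refine (HasDerivAt.fun_sum fun x _ => ?_).sub_const _
    have hx0 := (hu x t ht).1.ne'
    have hx1 := (sub_pos.2 (hu x t ht).2).ne'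
    cases hηx : η x
    · simp only [bern, bval, chi, Bool.false_eq_true, if_false]
      refine (((hderiv x).const_sub 1).log hx1).congr_deriv ?_
      field_simp
      ring
    · simp only [bern, bval, chi, if_true]
      refine ((hderiv x).log hx0).congr_deriv ?_
      field_simp
  refine hsum.congr_of_eventuallyEq ?_
  filter_upwards [hI.mem_nhds ht] with s hs
  have hpos : ∀ x, bern (u x s) (η x) ≠ 0 := fun x => (bern_pos (hu x s hs) _).ne'
  rw [prodM, Real.log_div (Finset.prod_ne_zero_iff.2 fun x _ => hpos x) ha,
    Real.log_prod fun x _ => hpos x]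

/-- Corollary `Cor:2.6`: the full identity for
`L_N^{*,ν_t}𝟙(η) - ∂_t log ψ_t(η)` where `ν_t` is the product measure with differentiable
means `u_x(t) ∈ (0,1)`, for reversible exchange rates and decomposed flip rates.
`g t` denotes `L_N^{*,ν_t}𝟙` (adjoint identity `hg`) and `ψdot t η` denotes
`∂_t log ψ_t(η)` (hypothesis `hψ`). -/
theorem stmt_10 (d N : ℕ) [NeZero N] (hN : 1 ≤ N) (K : ℝ) (hK : 1 ≤ K)
    (I : Set ℝ) (hI : IsOpen I)
    (u u' : Tor d N → ℝ → ℝ)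
    (hrange : ∀ x : Tor d N, ∀ t ∈ I, u x t ∈ Set.Ioo (0:ℝ) 1)
    (hderiv : ∀ x : Tor d N, ∀ t ∈ I, HasDerivAt (u x) (u' x t) t)
    (cc : Tor d N → Tor d N → Conf d N → ℝ)
    (hpos : ∀ (x : Tor d N) (i : Fin d) (η : Conf d N),
      0 < cc x (x + uvec d N i) η ∧ 0 < cc x (x - uvec d N i) η)
    (hsym : ∀ x y η, cc x y η = cc y x η)
    (hrev : ∀ (x : Tor d N) (i : Fin d) (η : Conf d N),
      cc x (x + uvec d N i) (exchT η x (x + uvec d N i)) = cc x (x + uvec d N i) η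
      ∧ cc x (x - uvec d N i) (exchT η x (x - uvec d N i)) = cc x (x - uvec d N i) η)
    (cG cp cm : Tor d N → Conf d N → ℝ)
    (hcG : ∀ x η, 0 ≤ cG x η)
    (hdecomp : ∀ x η, cG x η = cp x η * (1 - bval (η x)) + cm x η * bval (η x))
    (hcp_indep : ∀ (x : Tor d N) (η : Conf d N) (b : Bool),
      cp x (Function.update η x b) = cp x η)
    (hcm_indep : ∀ (x : Tor d N) (η : Conf d N) (b : Bool),
      cm x (Function.update η x b) = cm x η)
    (m : Conf d N → ℝ) (hm_pos : ∀ η, 0 < m η) (hm1 : ∑ η : Conf d N, m η = 1)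
    (ψdot : ℝ → Conf d N → ℝ)
    (hψ : ∀ (η : Conf d N), ∀ t ∈ I,
      HasDerivAt (fun s => Real.log (prodM d N (fun x => u x s) η / m η)) (ψdot t η) t)
    (g : ℝ → Conf d N → ℝ)
    (hg : ∀ t ∈ I, ∀ f : Conf d N → ℝ,
      ∑ η : Conf d N, ((N:ℝ)^2 * LK d N cc f η + K * LG d N cG f η)
          * prodM d N (fun x => u x t) η
        = ∑ η : Conf d N, g t η * f η * prodM d N (fun x => u x t) η) :
    ∀ t ∈ I, ∀ η : Conf d N,
      g t η - ψdot t η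
        = -((N:ℝ)^2 / 2) * nnSum d N (fun x y =>
              ((u y t - u x t)^2 / (chi (u x t) * chi (u y t))) * cc x y η
                * (bval (η x) - u x t) * (bval (η y) - u y t))
          + ((N:ℝ)^2 / 2) * nnSum d N (fun x y =>
              cc x y η
                * ((bval (η x) - u x t) / chi (u x t) - (bval (η y) - u y t) / chi (u y t))
                * (u y t - u x t))
          + K * ∑ x : Tor d N,
              (cp x η / u x t - cm x η / (1 - u x t)) * (bval (η x) - u x t)
          - ∑ x : Tor d N, u' x t * (bval (η x) - u x t) / chi (u x t) := by
  intro t ht η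
  have hu : ∀ x, u x t ∈ Set.Ioo (0 : ℝ) 1 := fun x => hrange x t ht
  have hψt := (hψ η t ht).unique (hasDerivAt_log_prodM_div d N u (fun x => u' x t) I hI hrange t ht
    (fun x => hderiv x t ht) η (m η) (hm_pos η).ne')
  have hgt := congrFun (eq_of_forall_sum_mul_eq (prodM d N fun x => u x t) (g t)
    (fun η => (N : ℝ) ^ 2
        * (1 / 2 * nnSum d N (fun x y => cc x y η * exchDefect (fun x => u x t) η x y))
      + K * ∑ x, (cp x η / u x t - cm x η / (1 - u x t)) * (bval (η x) - u x t))
    (fun η => (prodM_pos d N _ hu η).ne') fun f => by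
      rw [← hg t ht f]
      simp only [add_mul, Finset.sum_add_distrib, mul_assoc ((N : ℝ) ^ 2), mul_assoc K,
        ← Finset.mul_sum]
      rw [sum_LK_mul_prodM d N _ hu cc hrev f,
        sum_LG_mul_prodM d N _ hu cG cp cm hdecomp hcp_indep hcm_indep f]) η
  have hsplit : nnSum d N (fun x y => cc x y η * exchDefect (fun x => u x t) η x y)
      = -nnSum d N (fun x y => ((u y t - u x t) ^ 2 / (chi (u x t) * chi (u y t))) * cc x y η
            * (bval (η x) - u x t) * (bval (η y) - u y t))
        + nnSum d N (fun x y => cc x y η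
            * ((bval (η x) - u x t) / chi (u x t) - (bval (η y) - u y t) / chi (u y t))
            * (u y t - u x t)) := by
    simp only [nnSum, ← Finset.sum_neg_distrib, ← Finset.sum_add_distrib]
    refine Finset.sum_congr rfl fun x _ => Finset.sum_congr rfl fun i _ => ?_
    simp only [exchDefect]
    ring
  rw [hgt, hψt, hsplit]
  ring

end
end GK
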